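/- Let d > 0, b = (−d/2, 0), m = (d/2, 0) in ℝ², λ > 0, widths w₁, …, w_{n_w} > 0, orientations θ₁, …, θ_{n_θ} ∈ (0, π/2), W̄ = (1/n_w) Σ_i w_i, and ρ(r) = exp( −(λ/(n_w n_θ)) Σ_i Σ_j [ μ₂(L_{[b,r]} ⊕ R_{w_i,θ_j,0}) + μ₂(L_{[r,m]} ⊕ R_{w_i,θ_j,0}) ] ). Then for every θ ∈ (0, π/2), the improper integral ∫_{(d/2)cos θ}^{∞} ρ( R_θ⁻¹ (x, −d² sin(2θ)/(8x)) ) dx converges and is strictly less than 1/(2 λ W̄). -/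

import Mathlib

open Real MeasureTheory Pointwise

/-- Euclidean norm on `ℝ × ℝ`. -/
noncomputable def norm2 (p : ℝ × ℝ) : ℝ := Real.sqrt (p.1 ^ 2 + p.2 ^ 2)

/-- Counterclockwise rotation by `θ` on `ℝ × ℝ` (this is `R_θ⁻¹`). -/
noncomputable def rotCCW (θ : ℝ) (p : ℝ × ℝ) : ℝ × ℝ :=
  (p.1 * Real.cos θ - p.2 * Real.sin θ, p.1 * Real.sin θ + p.2 * Real.cos θ)

/-- The closed square `R_{w,θ,0}` of side length `w` centered at the origin with edges
rotated counterclockwise by `θ`. -/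
noncomputable def reflSquare (w θ : ℝ) : Set (ℝ × ℝ) :=
  rotCCW θ '' (Set.Icc (-(w / 2)) (w / 2) ×ˢ Set.Icc (-(w / 2)) (w / 2))

/-- The rotated square of side `w` contains the disc of radius `w / 2`. -/
theorem mem_reflSquare_of_sq_add_sq_le {w : ℝ} (hw : 0 ≤ w) (φ : ℝ) {z : ℝ × ℝ}
    (hz : z.1 ^ 2 + z.2 ^ 2 ≤ (w / 2) ^ 2) : z ∈ reflSquare w φ := by
  have hcs := Real.sin_sq_add_cos_sq φ
  have hsum : (z.1 * cos φ + z.2 * sin φ) ^ 2 + (-z.1 * sin φ + z.2 * cos φ) ^ 2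
      ≤ (w / 2) ^ 2 := by
    have : (z.1 * cos φ + z.2 * sin φ) ^ 2 + (-z.1 * sin φ + z.2 * cos φ) ^ 2
        = (z.1 ^ 2 + z.2 ^ 2) * (sin φ ^ 2 + cos φ ^ 2) := by ring
    rw [this, hcs, mul_one]
    exact hz
  have hw2 : 0 ≤ w / 2 := by positivity
  refine ⟨(z.1 * cos φ + z.2 * sin φ, -z.1 * sin φ + z.2 * cos φ), ⟨?_, ?_⟩, ?_⟩
  · exact abs_le.1 (abs_le_of_sq_le_sq (by nlinarith [sq_nonneg (-z.1 * sin φ + z.2 * cos φ)]) hw2)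
  · exact abs_le.1 (abs_le_of_sq_le_sq (by nlinarith [sq_nonneg (z.1 * cos φ + z.2 * sin φ)]) hw2)
  · ext
    · simp only [rotCCW]
      linear_combination z.1 * hcs
    · simp only [rotCCW]
      linear_combination z.2 * hcs

theorem continuous_rotCCW (φ : ℝ) : Continuous (rotCCW φ) := by
  unfold rotCCW
  fun_prop

theorem isCompact_reflSquare (w φ : ℝ) : IsCompact (reflSquare w φ) :=
  (isCompact_Icc.prod isCompact_Icc).image (continuous_rotCCW φ)

theorem isCompact_segment_add_reflSquare (p q : ℝ × ℝ) (w φ : ℝ) :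
    IsCompact (segment ℝ p q + reflSquare w φ) := by
  refine IsCompact.add ?_ (isCompact_reflSquare w φ)
  rw [segment_eq_image]
  exact isCompact_Icc.image (by fun_prop)

theorem norm2_nonneg (p : ℝ × ℝ) : 0 ≤ norm2 p := Real.sqrt_nonneg _

theorem norm2_sq (p : ℝ × ℝ) : norm2 p ^ 2 = p.1 ^ 2 + p.2 ^ 2 := Real.sq_sqrt (by positivity)

theorem inner_direction_le_norm2 (p : ℝ × ℝ) (θ : ℝ) : p.1 * cos θ + p.2 * sin θ ≤ norm2 p := by
  refine Real.le_sqrt_of_sq_le ?_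
  nlinarith [sq_nonneg (p.1 * sin θ - p.2 * cos θ), Real.sin_sq_add_cos_sq θ,
    congrArg (fun t => (p.1 ^ 2 + p.2 ^ 2) * t) (Real.sin_sq_add_cos_sq θ)]

/-- The sausage around a segment has area at least width times length. -/
theorem mul_norm2_le_volume_segment_add_reflSquare (p q : ℝ × ℝ) {w : ℝ} (hw : 0 ≤ w) (φ : ℝ) :
    w * norm2 (q - p) ≤ (volume (segment ℝ p q + reflSquare w φ)).toReal := by
  set v := q - p with hv
  set l := norm2 v with hl
  rcases (norm2_nonneg v).eq_or_lt with h0 | hpos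
  · rw [hl, ← h0, mul_zero]
    exact ENNReal.toReal_nonneg
  have hl0 : l ≠ 0 := hpos.ne'
  have hl2 : l ^ 2 = v.1 ^ 2 + v.2 ^ 2 := norm2_sq v
  let A : ℝ × ℝ →ₗ[ℝ] ℝ × ℝ := Matrix.toLin (Module.Basis.finTwoProd ℝ)
    (Module.Basis.finTwoProd ℝ) !![v.1, -v.2; v.2, v.1]
  have hA : ∀ x, A x = (v.1 * x.1 + -v.2 * x.2, v.2 * x.1 + v.1 * x.2) :=
    Matrix.toLin_finTwoProd_apply _ _ _ _
  have hdet : LinearMap.det A = l ^ 2 := by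
    rw [LinearMap.det_toLin, Matrix.det_fin_two_of, hl2]
    ring
  set S : Set (ℝ × ℝ) := Set.Icc 0 1 ×ˢ Set.Icc (-(w / (2 * l))) (w / (2 * l)) with hS
  have hvol : volume ((fun x => p + x) '' (A '' S)) = ENNReal.ofReal (w * l) := by
    rw [Set.image_add_left, measure_preimage_add, Measure.addHaar_image_linearMap, hdet, hS,
      Measure.volume_eq_prod, Measure.prod_prod, Real.volume_Icc, Real.volume_Icc,
      ← ENNReal.ofReal_mul (by norm_num), ← ENNReal.ofReal_mul (by positivity),
      abs_of_nonneg (by positivity)]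
    congr 1
    field_simp
    ring
  have hsub : (fun x => p + x) '' (A '' S) ⊆ segment ℝ p q + reflSquare w φ := by
    rintro _ ⟨_, ⟨⟨t, s⟩, ⟨ht, hs⟩, rfl⟩, rfl⟩
    refine Set.mem_add.2 ⟨p + t • v, ?_, (-v.2 * s, v.1 * s), ?_, ?_⟩
    · rw [segment_eq_image']
      exact ⟨t, ht, rfl⟩
    · apply mem_reflSquare_of_sq_add_sq_le hw
      have hs' : s ^ 2 ≤ (w / (2 * l)) ^ 2 := sq_le_sq' hs.1 hs.2
      calc (-v.2 * s) ^ 2 + (v.1 * s) ^ 2 = l ^ 2 * s ^ 2 := by rw [hl2]; ring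
        _ ≤ l ^ 2 * (w / (2 * l)) ^ 2 := by gcongr
        _ = (w / 2) ^ 2 := by field_simp
    · simp only [hA]
      ext <;> simp <;> ring
  have hle := (isCompact_segment_add_reflSquare p q w φ).measure_lt_top (μ := volume)
  rw [← ENNReal.toReal_ofReal (by positivity : 0 ≤ w * l), ← hvol]
  exact ENNReal.toReal_mono hle.ne (measure_mono hsub)

theorem measurable_volume_segment_add {K : Set (ℝ × ℝ)} (hK : IsClosed K) (p : ℝ × ℝ) :
    Measurable fun r : ℝ × ℝ => volume (segment ℝ p r + K) := by
  have hC : IsClosed {x : (ℝ × ℝ) × (ℝ × ℝ) | x.2 ∈ segment ℝ p x.1 + K} := by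
    have hD : IsClosed {y : Set.Icc (0 : ℝ) 1 × ((ℝ × ℝ) × (ℝ × ℝ)) |
        y.2.2 - (p + (y.1 : ℝ) • (y.2.1 - p)) ∈ K} := hK.preimage (by fun_prop)
    convert isClosedMap_snd_of_compactSpace _ hD using 1
    ext x
    simp only [Set.mem_ofPred_eq, Set.mem_add, segment_eq_image', Set.mem_image]
    constructor
    · rintro ⟨_, ⟨t, ht, rfl⟩, z, hz, h⟩
      exact ⟨(⟨t, ht⟩, x), by simpa [← h] using hz, rfl⟩
    · rintro ⟨⟨t, y⟩, hy, rfl⟩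
      exact ⟨_, ⟨t, t.2, rfl⟩, _, hy, by abel⟩
  exact measurable_measure_prodMk_left (ν := (volume : Measure (ℝ × ℝ))) hC.measurableSet

/-- The improper integral of the visibility probability `ρ` along the first-quadrant
branch of the reflection hyperbola converges, and is strictly less than `1/(2 λ W̄)`. -/
theorem stmt11 (d lam : ℝ) (hd : 0 < d) (hlam : 0 < lam)
    (nw nθ : ℕ) (hnw : 0 < nw) (hnθ : 0 < nθ)
    (w : Fin nw → ℝ) (hw : ∀ i, 0 < w i)
    (θs : Fin nθ → ℝ) (hθs : ∀ j, θs j ∈ Set.Ioo 0 (π / 2))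
    (b m : ℝ × ℝ) (hb : b = (-(d / 2), 0)) (hm : m = (d / 2, 0))
    (Wbar : ℝ) (hW : Wbar = (∑ i, w i) / nw)
    (ρ : ℝ × ℝ → ℝ)
    (hρ : ∀ r : ℝ × ℝ, ρ r =
      Real.exp (-(lam / (nw * nθ)) *
        ∑ i, ∑ j,
          ((volume (segment ℝ b r + reflSquare (w i) (θs j))).toReal +
            (volume (segment ℝ r m + reflSquare (w i) (θs j))).toReal)))
    (θ : ℝ) (hθ : θ ∈ Set.Ioo 0 (π / 2)) :
    IntegrableOn
        (fun x : ℝ => ρ (rotCCW θ (x, -(d ^ 2 * Real.sin (2 * θ)) / (8 * x))))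
        (Set.Ici (d / 2 * Real.cos θ)) volume ∧
      (∫ x in Set.Ici (d / 2 * Real.cos θ),
          ρ (rotCCW θ (x, -(d ^ 2 * Real.sin (2 * θ)) / (8 * x)))) <
        1 / (2 * lam * Wbar) := by
  have hnw' : (0 : ℝ) < nw := Nat.cast_pos.2 hnw
  have hnθ' : (0 : ℝ) < nθ := Nat.cast_pos.2 hnθ
  have : Nonempty (Fin nw) := ⟨⟨0, hnw⟩⟩
  have hWpos : 0 < Wbar := by
    rw [hW]
    exact div_pos (Finset.sum_pos (fun i _ => hw i) Finset.univ_nonempty) hnw'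
  have hmeas : Measurable ρ := by
    have hseg : ∀ (p : ℝ × ℝ) i j, Measurable fun r : ℝ × ℝ =>
        (volume (segment ℝ p r + reflSquare (w i) (θs j))).toReal := fun p i j =>
      (measurable_volume_segment_add (isCompact_reflSquare _ _).isClosed p).ennreal_toReal
    rw [funext hρ]
    simp only [segment_symm ℝ _ m]
    refine Real.measurable_exp.comp (Measurable.const_mul ?_ _)
    exact Finset.measurable_fun_sum _ fun i _ => Finset.measurable_fun_sum _ fun j _ =>
      (hseg b i j).add (hseg m i j)
  have hbound : ∀ x y : ℝ, ρ (rotCCW θ (x, y)) ≤ exp (-(2 * lam * Wbar) * x) := by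
    intro x y
    set r := rotCCW θ (x, y) with hr
    have hlen : 2 * x ≤ norm2 (r - b) + norm2 (m - r) := by
      have h1 := inner_direction_le_norm2 (r - b) θ
      have h2 := inner_direction_le_norm2 (m - r) (θ + π)
      rw [cos_add_pi, sin_add_pi] at h2
      simp only [hr, hb, hm, rotCCW, Prod.fst_sub, Prod.snd_sub] at h1 h2 ⊢
      linarith [congrArg (fun t => x * t) (Real.sin_sq_add_cos_sq θ)]
    rw [hρ]
    refine Real.exp_le_exp.2 ?_
    have hsum : nw * nθ * Wbar * (2 * x) ≤ ∑ i, ∑ j,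
        ((volume (segment ℝ b r + reflSquare (w i) (θs j))).toReal +
          (volume (segment ℝ r m + reflSquare (w i) (θs j))).toReal) := by
      calc nw * nθ * Wbar * (2 * x)
          ≤ nw * nθ * Wbar * (norm2 (r - b) + norm2 (m - r)) := by gcongr
        _ = ∑ i, ∑ _j : Fin nθ, (w i * norm2 (r - b) + w i * norm2 (m - r)) := by
            simp only [Finset.sum_const, Finset.card_univ, Fintype.card_fin, nsmul_eq_mul,
              ← mul_add, ← Finset.mul_sum, ← Finset.sum_mul]
            rw [hW]
            field_simp
        _ ≤ _ := by
            gcongr with i _ j _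
            · exact mul_norm2_le_volume_segment_add_reflSquare _ _ (hw i).le _
            · exact mul_norm2_le_volume_segment_add_reflSquare _ _ (hw i).le _
    calc _ ≤ -(lam / (nw * nθ)) * (nw * nθ * Wbar * (2 * x)) :=
          mul_le_mul_of_nonpos_left hsum (neg_nonpos.2 (by positivity))
      _ = _ := by field_simp
  have ha : -(2 * lam * Wbar) < 0 := neg_neg_iff_pos.2 (by positivity)
  have hint : IntegrableOn (fun x : ℝ => exp (-(2 * lam * Wbar) * x))
      (Set.Ici (d / 2 * cos θ)) := by
    rw [integrableOn_Ici_iff_integrableOn_Ioi]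
    exact integrableOn_exp_mul_Ioi ha _
  have hρint : IntegrableOn
      (fun x : ℝ => ρ (rotCCW θ (x, -(d ^ 2 * Real.sin (2 * θ)) / (8 * x))))
      (Set.Ici (d / 2 * Real.cos θ)) volume := by
    refine Integrable.mono' hint ?_ (.of_forall fun x => ?_)
    · refine (hmeas.comp ((continuous_rotCCW θ).measurable.comp ?_)).aestronglyMeasurable
      fun_prop
    · rw [Real.norm_of_nonneg (by rw [hρ]; positivity)]
      exact hbound _ _
  refine ⟨hρint, (setIntegral_mono hρint hint fun x => hbound _ _).trans_lt ?_⟩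
  have hcos : 0 < cos θ := cos_pos_of_mem_Ioo ⟨by linarith [hθ.1, pi_pos], hθ.2⟩
  rw [integral_Ici_eq_integral_Ioi, integral_exp_mul_Ioi ha, neg_div_neg_eq]
  gcongr
  exact Real.exp_lt_one_iff.2 (mul_neg_of_neg_of_pos ha (by positivity))
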